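/- (Theorem 1) Let w be a braid word on n strands with m letters and w' a braid word on n' strands with m' letters. Then the linking matrices M(w) and M(w') are equal (in particular, n + m = n' + m') if and only if n = n' and w is B0-equivalent to w'. Consequently, the correspondence w ↦ M(w) defines a bijection from the set of braid diagrams (B0-equivalence classes of braid words) onto the set of linking matrices. -/

import Mathlib

open Matrix

/-- A letter of a braid word: a pair (column, sign). -/
abbrev Letter : Type := ℕ × ℤ

/-- A cycle on the laundry surface: `Sum.inl i` is the circle cycle `C_i` (1-indexed),
`Sum.inr k` is the band cycle `X_{k+1}` (i.e. the band of the letter in position `k`,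
0-indexed). -/
abbrev Cyc : Type := ℕ ⊕ ℕ

/-- `w` is a braid word on `n` strands: `n ≥ 2`, `w` nonempty, and each letter `(c, ε)`
has column `1 ≤ c ≤ n - 1` and sign `ε = ±1`. -/
def IsBraidWord (n : ℕ) (w : List Letter) : Prop :=
  2 ≤ n ∧ w ≠ [] ∧ ∀ ℓ ∈ w, 1 ≤ ℓ.1 ∧ ℓ.1 ≤ n - 1 ∧ (ℓ.2 = 1 ∨ ℓ.2 = -1)

/-- A single B0 move: swap two adjacent letters whose columns differ by more than 1. -/
inductive B0Step : List Letter → List Letter → Prop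
  | swap (u v : List Letter) (a b : Letter)
      (h : 1 < (a.1 : ℤ) - (b.1 : ℤ) ∨ 1 < (b.1 : ℤ) - (a.1 : ℤ)) :
      B0Step (u ++ a :: b :: v) (u ++ b :: a :: v)

/-- B0-equivalence: a finite sequence of B0 moves. -/
def B0Equiv : List Letter → List Letter → Prop := Relation.ReflTransGen B0Step

/-- The column of the `k`-th letter (0-indexed) of `w`. -/
def colOf (w : List Letter) (k : ℕ) : ℕ := (w.getD k (0, 0)).1

/-- The sign of the `k`-th letter (0-indexed) of `w`. -/
def signOf (w : List Letter) (k : ℕ) : ℤ := (w.getD k (0, 0)).2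

/-- The band cycles `X_k` with column `c_k ∈ {e - 1, e}`, in decreasing order of `k`. -/
def bandBlock (w : List Letter) (e : ℕ) : List Cyc :=
  ((List.range w.length).reverse.filter fun k => colOf w k == e - 1 || colOf w k == e).map
    Sum.inr

/-- The cycles of `w` in laundry order: for each even `e = 2, 4, …, ≤ n` in increasing
order, the circle `C_e` followed by all bands `X_k` with `c_k ∈ {e-1, e}` in decreasing
order of `k`; then the circles `C_i` for odd `i ≤ n` in decreasing order of `i`. -/
def laundryList (n : ℕ) (w : List Letter) : List Cyc :=
  (((List.range (n + 1)).filter fun e => e % 2 == 0 && e != 0).flatMap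
      fun e => Sum.inl e :: bandBlock w e) ++
    ((List.range (n + 1)).filter fun i => i % 2 == 1).reverse.map Sum.inl

/-- The linking number of (the double push-off of) one cycle of `w` with another. -/
def entry (w : List Letter) : Cyc → Cyc → ℤ
  | Sum.inl _, Sum.inl _ => 0
  | Sum.inr k, Sum.inr l =>
      if k = l then signOf w k
      else if (colOf w l = colOf w k + 1 ∧ k < l) ∨ (colOf w l + 1 = colOf w k ∧ l < k) then 1
      else 0
  | Sum.inr k, Sum.inl j =>
      if j = colOf w k then -1 else if j = colOf w k + 1 then 1 else 0
  | Sum.inl j, Sum.inr k =>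
      if j = colOf w k then -1 else if j = colOf w k + 1 then 1 else 0

/-- The linking matrix `M(w)` of a braid word `w` with `m` letters on `n` strands:
the `(n+m) × (n+m)` integer matrix of linking numbers, rows and columns indexed by the
cycles of `w` in laundry order. -/
def linkMat (n m : ℕ) (w : List Letter) : Matrix (Fin (n + m)) (Fin (n + m)) ℤ :=
  fun p q =>
    entry w ((laundryList n w).getD p (Sum.inl 0)) ((laundryList n w).getD q (Sum.inl 0))

/-- A relabelling of positions carrying `w` to `w'` which preserves letters and the relative
order of any two letters whose columns differ by at most one. -/
structure IsRelabelling (w w' : List Letter) (f : ℕ → ℕ) : Prop where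
  length_eq : w'.length = w.length
  lt : ∀ k < w.length, f k < w.length
  letter : ∀ k < w.length, w'.getD (f k) (0, 0) = w.getD k (0, 0)
  mono : ∀ k l, k < l → l < w.length → colOf w l ≤ colOf w k + 1 → colOf w k ≤ colOf w l + 1 →
    f k < f l

namespace IsRelabelling

variable {w w' : List Letter} {f : ℕ → ℕ}

lemma colOf_eq (h : IsRelabelling w w' f) {k : ℕ} (hk : k < w.length) :
    colOf w' (f k) = colOf w k := by
  unfold colOf; rw [h.letter k hk]

lemma signOf_eq (h : IsRelabelling w w' f) {k : ℕ} (hk : k < w.length) :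
    signOf w' (f k) = signOf w k := by
  unfold signOf; rw [h.letter k hk]

lemma injOn (h : IsRelabelling w w' f) {k l : ℕ} (hk : k < w.length) (hl : l < w.length)
    (e : f k = f l) : k = l := by
  have hc : colOf w k = colOf w l := by rw [← h.colOf_eq hk, ← h.colOf_eq hl, e]
  rcases lt_trichotomy k l with hlt | rfl | hlt
  · have := h.mono k l hlt hl (by omega) (by omega); omega
  · rfl
  · have := h.mono l k hlt hk (by omega) (by omega); omega

lemma lt_iff (h : IsRelabelling w w' f) {k l : ℕ} (hk : k < w.length) (hl : l < w.length)
    (h₁ : colOf w l ≤ colOf w k + 1) (h₂ : colOf w k ≤ colOf w l + 1) :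
    f k < f l ↔ k < l := by
  refine ⟨fun hf => ?_, fun hlt => h.mono k l hlt hl h₁ h₂⟩
  by_contra hn
  rcases (not_lt.mp hn).lt_or_eq with hlt | rfl
  · have := h.mono l k hlt hk h₂ h₁; omega
  · exact lt_irrefl _ hf

lemma surjOn (h : IsRelabelling w w' f) {l : ℕ} (hl : l < w.length) :
    ∃ k < w.length, f k = l := by
  have := Finset.surj_on_of_inj_on_of_card_le (s := Finset.range w.length)
    (t := Finset.range w.length) (fun k _ => f k)
    (fun k hk => Finset.mem_range.mpr (h.lt k (Finset.mem_range.mp hk)))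
    (fun k l hk hl e => h.injOn (Finset.mem_range.mp hk) (Finset.mem_range.mp hl) e) le_rfl
    l (Finset.mem_range.mpr hl)
  obtain ⟨k, hk, e⟩ := this
  exact ⟨k, Finset.mem_range.mp hk, e.symm⟩

/-- A relabelling carries the positions of letters with columns in a set of diameter at most
one to the corresponding positions, in the same order. -/
lemma filter_range (h : IsRelabelling w w' f) (P : ℕ → Bool)
    (hP : ∀ c d, P c → P d → c ≤ d + 1) :
    (List.range w'.length).filter (fun k => P (colOf w' k)) =
      ((List.range w.length).filter fun k => P (colOf w k)).map f := by
  have hs : ((List.range w'.length).filter (fun k => P (colOf w' k))).Pairwise (· < ·) :=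
    List.pairwise_lt_range.filter _
  have hs' : (((List.range w.length).filter fun k => P (colOf w k)).map f).Pairwise (· < ·) := by
    rw [List.pairwise_map]
    refine List.Pairwise.imp_of_mem ?_ (List.pairwise_lt_range.filter _)
    intro a b ha hb hab
    simp only [List.mem_filter, List.mem_range] at ha hb
    exact h.mono a b hab hb.1 (hP _ _ hb.2 ha.2) (hP _ _ ha.2 hb.2)
  refine List.Perm.eq_of_pairwise (le := (· < ·)) (fun a b _ _ h₁ h₂ => absurd h₁ h₂.asymm) hs hs' ?_
  refine (List.perm_ext_iff_of_nodup (hs.imp ne_of_lt) (hs'.imp ne_of_lt)).mpr fun l => ?_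
  simp only [List.mem_filter, List.mem_range, List.mem_map, h.length_eq]
  constructor
  · rintro ⟨hl, hp⟩
    obtain ⟨k, hk, rfl⟩ := h.surjOn hl
    exact ⟨k, ⟨hk, by rwa [h.colOf_eq hk] at hp⟩, rfl⟩
  · rintro ⟨k, ⟨hk, hp⟩, rfl⟩
    exact ⟨h.lt k hk, by rwa [h.colOf_eq hk]⟩

end IsRelabelling

/-- The positions underlying `bandBlock`. -/
def bandIdx (w : List Letter) (e : ℕ) : List ℕ :=
  ((List.range w.length).filter fun k => colOf w k == e - 1 || colOf w k == e).reverse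

lemma bandBlock_eq (w : List Letter) (e : ℕ) : bandBlock w e = (bandIdx w e).map Sum.inr := by
  rw [bandBlock, bandIdx, List.filter_reverse]

lemma mem_bandIdx {w : List Letter} {e k : ℕ} :
    k ∈ bandIdx w e ↔ k < w.length ∧ (colOf w k = e - 1 ∨ colOf w k = e) := by
  simp [bandIdx]

lemma pairwise_bandIdx (w : List Letter) (e : ℕ) : (bandIdx w e).Pairwise (· > ·) := by
  rw [bandIdx, List.pairwise_reverse]
  exact List.pairwise_lt_range.filter _

/-- The positive even integers up to `n`. -/
def evens (n : ℕ) : List ℕ := (List.range (n + 1)).filter fun e => e % 2 == 0 && e != 0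

/-- The odd integers up to `n`, in decreasing order. -/
def odds (n : ℕ) : List ℕ := ((List.range (n + 1)).filter fun i => i % 2 == 1).reverse

lemma mem_evens {n e : ℕ} : e ∈ evens n ↔ e ≤ n ∧ e % 2 = 0 ∧ e ≠ 0 := by
  simp [evens]

lemma mem_odds {n e : ℕ} : e ∈ odds n ↔ e ≤ n ∧ e % 2 = 1 := by
  simp [odds]

lemma laundryList_eq (n : ℕ) (w : List Letter) :
    laundryList n w = ((evens n).flatMap fun e => Sum.inl e :: (bandIdx w e).map Sum.inr) ++
      (odds n).map Sum.inl := by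
  simp only [laundryList, bandBlock_eq, evens, odds]

lemma laundryList_map {w w' : List Letter} {f : ℕ → ℕ} (h : IsRelabelling w w' f) (n : ℕ) :
    laundryList n w' = (laundryList n w).map (Sum.map id f) := by
  have hb : ∀ e, bandIdx w' e = (bandIdx w e).map f := fun e => by
    have := h.filter_range (fun c => c == e - 1 || c == e) (by simp; omega)
    simp only [bandIdx, this, List.map_reverse]
  simp [laundryList_eq, hb, List.map_flatMap, Function.comp_def]

lemma mem_laundryList {n : ℕ} {w : List Letter} (hw : IsBraidWord n w) {x : Cyc} :
    x ∈ laundryList n w ↔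
      (∃ i, 1 ≤ i ∧ i ≤ n ∧ x = Sum.inl i) ∨ ∃ k < w.length, x = Sum.inr k := by
  simp only [laundryList_eq, List.mem_append, List.mem_flatMap, List.mem_cons, List.mem_map,
    mem_evens, mem_odds, mem_bandIdx]
  constructor
  · rintro (⟨e, he, rfl | ⟨k, hk, rfl⟩⟩ | ⟨i, hi, rfl⟩)
    · exact .inl ⟨e, by omega, by omega, rfl⟩
    · exact .inr ⟨k, hk.1, rfl⟩
    · exact .inl ⟨i, by omega, by omega, rfl⟩
  · rintro (⟨i, h₁, h₂, rfl⟩ | ⟨k, hk, rfl⟩)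
    · rcases Nat.mod_two_eq_zero_or_one i with h | h
      · exact .inl ⟨i, by omega, .inl rfl⟩
      · exact .inr ⟨i, by omega, rfl⟩
    · have hc : 1 ≤ colOf w k ∧ colOf w k ≤ n - 1 := by
        have := hw.2.2 _ (List.getElem_mem hk)
        simp only [colOf, List.getD_eq_getElem _ _ hk]
        exact ⟨this.1, this.2.1⟩
      have h2 := hw.1
      refine .inl ⟨(colOf w k + 1) / 2 * 2, by omega, .inr ⟨k, ⟨hk, by omega⟩, rfl⟩⟩

lemma nodup_laundryList (n : ℕ) (w : List Letter) : (laundryList n w).Nodup := by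
  have hE : (evens n).Nodup := List.nodup_range.filter _
  have hO : (odds n).Nodup := List.nodup_reverse.mpr (List.nodup_range.filter _)
  rw [laundryList_eq, List.nodup_append]
  refine ⟨List.nodup_flatMap.mpr ⟨fun e _ => ?_, ?_⟩, hO.map Sum.inl_injective, ?_⟩
  · refine List.nodup_cons.mpr ⟨by simp, List.Nodup.map Sum.inr_injective ?_⟩
    exact (pairwise_bandIdx w e).imp ne_of_gt
  · refine List.Pairwise.imp_of_mem ?_ hE
    intro a b ha hb hab x hxa hxb
    rw [mem_evens] at ha hb
    simp only [List.mem_cons, List.mem_map, mem_bandIdx] at hxa hxb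
    rcases hxa with rfl | ⟨k, hk, rfl⟩ <;> rcases hxb with h | ⟨l, hl, h⟩ <;> simp at h
    · exact hab h
    · subst h; omega
  · intro a ha b hb hab
    subst hab
    simp only [List.mem_flatMap, List.mem_cons, List.mem_map, mem_evens, mem_odds] at ha hb
    obtain ⟨i, hi, rfl⟩ := hb
    obtain ⟨e, he, h | ⟨k, hk, h⟩⟩ := ha <;> simp at h
    omega

lemma laundryList_perm {n : ℕ} {w : List Letter} (hw : IsBraidWord n w) :
    (laundryList n w).Perm
      ((List.range' 1 n).map Sum.inl ++ (List.range w.length).map Sum.inr) := by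
  refine (List.perm_ext_iff_of_nodup (nodup_laundryList n w) ?_).mpr fun x => ?_
  · refine List.nodup_append.mpr ⟨(List.nodup_range' (s := 1)).map Sum.inl_injective,
      List.nodup_range.map Sum.inr_injective, ?_⟩
    simp
  · rw [mem_laundryList hw]
    simp only [List.mem_append, List.mem_map, List.mem_range, List.mem_range'_1]
    refine or_congr ⟨?_, ?_⟩ ⟨?_, ?_⟩
    · rintro ⟨i, _, _, rfl⟩; exact ⟨i, by omega, rfl⟩
    · rintro ⟨i, _, rfl⟩; exact ⟨i, by omega, by omega, rfl⟩
    · rintro ⟨i, hi, rfl⟩; exact ⟨i, hi, rfl⟩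
    · rintro ⟨i, hi, rfl⟩; exact ⟨i, hi, rfl⟩

lemma length_laundryList {n : ℕ} {w : List Letter} (hw : IsBraidWord n w) :
    (laundryList n w).length = n + w.length := by
  rw [(laundryList_perm hw).length_eq]; simp

lemma countP_isLeft_laundryList {n : ℕ} {w : List Letter} (hw : IsBraidWord n w) :
    (laundryList n w).countP Sum.isLeft = n := by
  rw [(laundryList_perm hw).countP_eq, List.countP_append, List.countP_map, List.countP_map]
  simp [Function.comp_def]

lemma entry_relabel {w w' : List Letter} {f : ℕ → ℕ} (h : IsRelabelling w w' f) {x y : Cyc}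
    (hx : ∀ k, x = Sum.inr k → k < w.length) (hy : ∀ k, y = Sum.inr k → k < w.length) :
    entry w' (Sum.map id f x) (Sum.map id f y) = entry w x y := by
  rcases x with i | k <;> rcases y with j | l
  · rfl
  · simp [entry, h.colOf_eq (hy l rfl)]
  · simp [entry, h.colOf_eq (hx k rfl)]
  · have hk := hx k rfl
    have hl := hy l rfl
    have hkl : f k = f l ↔ k = l := ⟨h.injOn hk hl, congrArg f⟩
    simp only [entry, Sum.map_inr, h.colOf_eq hk, h.colOf_eq hl, h.signOf_eq hk, hkl]
    have h₁ : (colOf w l = colOf w k + 1 ∧ f k < f l) ↔ (colOf w l = colOf w k + 1 ∧ k < l) :=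
      and_congr_right fun e => h.lt_iff hk hl (by omega) (by omega)
    have h₂ : (colOf w l + 1 = colOf w k ∧ f l < f k) ↔ (colOf w l + 1 = colOf w k ∧ l < k) :=
      and_congr_right fun e => h.lt_iff hl hk (by omega) (by omega)
    simp only [h₁, h₂]

lemma linkMat_eq_of_isRelabelling {n m : ℕ} {w w' : List Letter} {f : ℕ → ℕ}
    (h : IsRelabelling w w' f) (hw : IsBraidWord n w) : linkMat n m w = linkMat n m w' := by
  have key : ∀ p, (laundryList n w').getD p (Sum.inl 0) =
      Sum.map id f ((laundryList n w).getD p (Sum.inl 0)) := fun p => by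
    rw [laundryList_map h, ← List.getD_map (f := Sum.map id f)]; rfl
  have hlt : ∀ p k, (laundryList n w).getD p (Sum.inl 0) = Sum.inr k → k < w.length := by
    intro p k e
    by_cases hp : p < (laundryList n w).length
    · rw [List.getD_eq_getElem _ _ hp] at e
      have := (mem_laundryList hw).mp (e ▸ List.getElem_mem hp)
      simpa using this
    · rw [List.getD_eq_default _ _ (not_lt.mp hp)] at e
      cases e
  ext p q
  simp only [linkMat, key]
  exact (entry_relabel h (hlt p) (hlt q)).symm

lemma B0Step.exists_isRelabelling {w w' : List Letter} (h : B0Step w w') :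
    ∃ f, IsRelabelling w w' f := by
  obtain ⟨u, v, a, b, h⟩ := h
  have get : ∀ (a b : Letter) (k : ℕ), (u ++ a :: b :: v).getD k (0, 0) =
      if k < u.length then u.getD k (0, 0) else if k = u.length then a
        else if k = u.length + 1 then b else v.getD (k - u.length - 2) (0, 0) := by
    intro a b k
    split_ifs with h₁ h₂ h₃
    · rw [List.getD_append _ _ _ _ h₁]
    · subst h₂; rw [List.getD_append_right _ _ _ _ le_rfl]; simp
    · subst h₃; rw [List.getD_append_right _ _ _ _ (by omega)]; simp
    · rw [List.getD_append_right _ _ _ _ (by omega)]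
      obtain ⟨j, hj⟩ : ∃ j, k - u.length = j + 2 := ⟨k - u.length - 2, by omega⟩
      rw [hj]; simp
  refine ⟨fun k => if k = u.length then u.length + 1 else if k = u.length + 1 then u.length else k,
    by simp, ?_, ?_, ?_⟩
  · intro k hk
    simp only [List.length_append, List.length_cons] at hk ⊢
    split_ifs <;> omega
  · intro k _
    simp only [get]
    split_ifs <;> first | rfl | omega
  · intro k l hkl hl h₁ h₂
    by_cases hkl' : k = u.length ∧ l = u.length + 1
    · obtain ⟨rfl, rfl⟩ := hkl'
      simp [colOf] at h₁ h₂
      omega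
    · split_ifs <;> omega

lemma IsBraidWord.b0Step {n : ℕ} {w w' : List Letter} (hw : IsBraidWord n w) (h : B0Step w w') :
    IsBraidWord n w' := by
  obtain ⟨u, v, a, b, h⟩ := h
  refine ⟨hw.1, by simp, fun x hx => hw.2.2 x ?_⟩
  simp only [List.mem_append, List.mem_cons] at hx ⊢
  tauto

lemma B0Equiv.length_eq_and_linkMat_eq {n : ℕ} {w w' : List Letter} (hw : IsBraidWord n w)
    (h : B0Equiv w w') :
    IsBraidWord n w' ∧ w.length = w'.length ∧ ∀ m, linkMat n m w = linkMat n m w' := by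
  induction h with
  | refl => exact ⟨hw, rfl, fun _ => rfl⟩
  | tail _ hs ih =>
    obtain ⟨f, hf⟩ := hs.exists_isRelabelling
    exact ⟨ih.1.b0Step hs, ih.2.1.trans hf.length_eq.symm, fun m =>
      (ih.2.2 m).trans (linkMat_eq_of_isRelabelling hf ih.1)⟩

/-! ### Words with equal projections to adjacent columns are equivalent -/

/-- Whether a letter lies in column `c` or `c + 1`. -/
def inCols (c : ℕ) (x : Letter) : Bool := x.1 == c || x.1 == c + 1

lemma B0Step.symm {w w' : List Letter} (h : B0Step w w') : B0Step w' w := by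
  obtain ⟨u, v, a, b, h⟩ := h
  exact .swap u v b a h.symm

lemma B0Equiv.cons {w w' : List Letter} (a : Letter) (h : B0Equiv w w') :
    B0Equiv (a :: w) (a :: w') := by
  refine Relation.ReflTransGen.lift (a :: ·) ?_ _ _ h
  rintro _ _ ⟨u, v, x, y, h⟩
  exact .swap (a :: u) v x y h

lemma b0Equiv_cons_append (a : Letter) (u v : List Letter)
    (h : ∀ x ∈ u, a.1 + 1 < x.1 ∨ x.1 + 1 < a.1) : B0Equiv (a :: (u ++ v)) (u ++ a :: v) := by
  induction u with
  | nil => exact .refl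
  | cons b u ih =>
    have hb := h b (by simp)
    refine Relation.ReflTransGen.head (.swap [] (u ++ v) a b (by omega)) ?_
    exact B0Equiv.cons b (ih fun x hx => h x (by simp [hx]))

lemma b0Equiv_of_filter_eq (w w' : List Letter)
    (h : ∀ c, w.filter (inCols c) = w'.filter (inCols c)) : B0Equiv w w' := by
  induction w generalizing w' with
  | nil =>
    cases w' with
    | nil => exact .refl
    | cons a t => have := h a.1; simp [inCols] at this
  | cons a t ih =>
    have ha : a ∈ w' := by
      have : a ∈ (a :: t).filter (inCols a.1) := by simp [inCols]
      rw [h] at this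
      exact (List.mem_filter.mp this).1
    obtain ⟨u, b, v, hb, rfl, hu⟩ : ∃ u b v, b.1 = a.1 ∧ w' = u ++ b :: v ∧
        ∀ x ∈ u, x.1 ≠ a.1 := by
      obtain ⟨b, hb⟩ := Option.isSome_iff_exists.mp
        (List.find?_isSome (p := fun x : Letter => x.1 == a.1).mpr ⟨a, ha, by simp⟩)
      obtain ⟨h₁, u, v, rfl, h₂⟩ := List.find?_eq_some_iff_append.mp hb
      exact ⟨u, b, v, by simpa using h₁, rfl, by simpa using h₂⟩
    have key : ∀ c, c = a.1 ∨ c + 1 = a.1 → b = a ∧ ∀ x ∈ u, ¬ inCols c x := by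
      intro c hc
      have hac : inCols c a := by simp only [inCols, Bool.or_eq_true, beq_iff_eq]; omega
      have hbc : inCols c b := by simp only [inCols, Bool.or_eq_true, beq_iff_eq]; omega
      have e := h c
      rw [List.filter_cons_of_pos hac, List.filter_append, List.filter_cons_of_pos hbc] at e
      rcases hf : u.filter (inCols c) with _ | ⟨y, ys⟩
      · rw [hf] at e
        simp only [List.nil_append, List.cons.injEq] at e
        exact ⟨e.1.symm, by simpa [List.filter_eq_nil_iff] using hf⟩
      · rw [hf] at e
        simp only [List.cons_append, List.cons.injEq] at e
        have : y ∈ u.filter (inCols c) := by simp [hf]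
        exact absurd (by rw [e.1]) (hu y (List.mem_filter.mp this).1)
    obtain ⟨rfl, k₁⟩ := key a.1 (.inl rfl)
    have hcomm : ∀ x ∈ u, b.1 + 1 < x.1 ∨ x.1 + 1 < b.1 := by
      intro x hx
      have h₁ := k₁ x hx
      have h₂ : x.1 + 1 ≠ b.1 := fun e => by
        have := (key x.1 (.inr e)).2 x hx
        simp [inCols] at this
      simp only [inCols, Bool.or_eq_true, beq_iff_eq] at h₁
      omega
    refine (B0Equiv.cons b (ih (u ++ v) fun c => ?_)).trans (b0Equiv_cons_append b u v hcomm)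
    have e := h c
    by_cases hbc : inCols c b
    · have hu0 : u.filter (inCols c) = [] := by
        rw [List.filter_eq_nil_iff]
        intro x hx
        have := hcomm x hx
        simp only [inCols, Bool.or_eq_true, beq_iff_eq] at hbc ⊢
        omega
      rw [List.filter_cons_of_pos hbc, List.filter_append, List.filter_cons_of_pos hbc, hu0] at e
      rw [List.filter_append, hu0]
      simpa using e
    · rwa [List.filter_cons_of_neg hbc, List.filter_append, List.filter_cons_of_neg hbc,
        ← List.filter_append] at e

lemma map_getD_filter_range (w : List Letter) (P : ℕ → Bool) :
    ((List.range w.length).filter fun k => P (colOf w k)).map (fun k => w.getD k (0, 0)) =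
      w.filter fun x => P x.1 := by
  have : w = (List.range w.length).map fun k => w.getD k (0, 0) := by
    apply List.ext_getElem <;> simp +contextual
  conv_rhs => rw [this, List.filter_map]
  rfl

lemma IsRelabelling.b0Equiv {w w' : List Letter} {f : ℕ → ℕ} (h : IsRelabelling w w' f) :
    B0Equiv w w' := by
  refine b0Equiv_of_filter_eq w w' fun c => ?_
  have e := h.filter_range (fun d => d == c || d == c + 1) (by simp; omega)
  refine (map_getD_filter_range w fun d => d == c || d == c + 1).symm.trans
    (Eq.trans ?_ (map_getD_filter_range w' fun d => d == c || d == c + 1))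
  rw [e, List.map_map]
  refine List.map_congr_left fun k hk => ?_
  exact (h.letter k (List.mem_range.mp (List.mem_filter.mp hk).1)).symm

/-! ### Recovering the word from the matrix -/

lemma replicate_append_inj {a b : ℕ} {r r' : List Bool} (hr : ∀ x ∈ r.head?, x = true)
    (hr' : ∀ x ∈ r'.head?, x = true)
    (h : List.replicate a false ++ r = List.replicate b false ++ r') : a = b ∧ r = r' := by
  induction a generalizing b with
  | zero =>
    cases b with
    | zero => simpa using h
    | succ b =>
      simp only [List.replicate_zero, List.nil_append] at h
      subst h
      simp [List.replicate_succ] at hr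
  | succ a ih =>
    cases b with
    | zero =>
      simp only [List.replicate_zero, List.nil_append] at h
      subst h
      simp [List.replicate_succ] at hr'
    | succ b =>
      simp only [List.replicate_succ, List.cons_append, List.cons.injEq, true_and] at h
      exact ⟨congrArg (· + 1) (ih h).1, (ih h).2⟩

lemma zip_blocks (b b' : ℕ → List ℕ) (E O : List ℕ)
    (h : ((E.flatMap fun e => (Sum.inl e : Cyc) :: (b e).map Sum.inr) ++
        O.map Sum.inl).map Sum.isLeft =
      ((E.flatMap fun e => (Sum.inl e : Cyc) :: (b' e).map Sum.inr) ++
        O.map Sum.inl).map Sum.isLeft) :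
    (∀ e ∈ E, (b e).length = (b' e).length) ∧
    ((E.flatMap fun e => (Sum.inl e : Cyc) :: (b e).map Sum.inr) ++ O.map Sum.inl).zip
        ((E.flatMap fun e => (Sum.inl e : Cyc) :: (b' e).map Sum.inr) ++ O.map Sum.inl) =
      (E.flatMap fun e => ((Sum.inl e : Cyc), (Sum.inl e : Cyc)) ::
        ((b e).zip (b' e)).map (Prod.map Sum.inr Sum.inr)) ++
      O.map fun i => ((Sum.inl i : Cyc), (Sum.inl i : Cyc)) := by
  induction E with
  | nil => simp [List.zip_map']
  | cons e E ih =>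
    have head : ∀ b : ℕ → List ℕ, ∀ x ∈ (((E.flatMap fun e => (Sum.inl e : Cyc) ::
        (b e).map Sum.inr) ++ O.map Sum.inl).map Sum.isLeft).head?, x = true := by
      intro b x
      cases E with
      | nil => cases O <;> simp
      | cons => simp
    have rep : ∀ l : List ℕ, (l.map (Sum.inr : ℕ → Cyc)).map Sum.isLeft =
        List.replicate l.length false := fun l => by
      rw [List.map_map]; exact List.map_const' ..
    simp only [List.flatMap_cons, List.cons_append, List.append_assoc, List.map_cons,
      List.map_append (l₁ := List.map Sum.inr _), rep, List.cons.injEq, true_and] at h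
    obtain ⟨hl, hr⟩ := replicate_append_inj (head b) (head b') h
    obtain ⟨ih₁, ih₂⟩ := ih hr
    refine ⟨by simpa using ⟨hl, ih₁⟩, ?_⟩
    simp only [List.flatMap_cons, List.cons_append, List.append_assoc, List.zip_cons_cons]
    rw [List.zip_append (by simpa using hl), ih₂, List.zip_map]

lemma lt_of_mem_zip {l l' : List ℕ} (hl : l.Pairwise (· > ·)) (hl' : l'.Pairwise (· > ·))
    {k k' i i' : ℕ} (h : (k, i) ∈ l.zip l') (h' : (k', i') ∈ l.zip l') (hk : k < k') : i < i' := by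
  obtain ⟨p, hp, e⟩ := List.getElem_of_mem h
  obtain ⟨q, hq, e'⟩ := List.getElem_of_mem h'
  simp only [List.getElem_zip, Prod.mk.injEq] at e e'
  simp only [List.length_zip, lt_inf_iff] at hp hq
  rcases lt_trichotomy p q with hpq | rfl | hpq
  · have := List.pairwise_iff_getElem.mp hl p q hp.1 hq.1 hpq; omega
  · omega
  · have := List.pairwise_iff_getElem.mp hl' q p hq.2 hp.2 hpq; omega

lemma isLeft_iff_entry_self_eq_zero {n : ℕ} {w : List Letter} (hw : IsBraidWord n w) {x : Cyc}
    (hx : x ∈ laundryList n w) : x.isLeft ↔ entry w x x = 0 := by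
  rcases (mem_laundryList hw).mp hx with ⟨i, _, _, rfl⟩ | ⟨k, hk, rfl⟩
  · simp [entry]
  · have := (hw.2.2 _ (List.getElem_mem hk)).2.2
    simp only [entry, signOf, List.getD_eq_getElem _ _ hk, if_true, Sum.isLeft_inr]
    constructor
    · simp
    · intro h; omega

lemma exists_isRelabelling_of_entry_eq {n : ℕ} {w w' : List Letter} (hw : IsBraidWord n w)
    (hlen : w'.length = w.length)
    (hleft : (laundryList n w).map Sum.isLeft = (laundryList n w').map Sum.isLeft)
    (hentry : ∀ x x' y y', (x, x') ∈ (laundryList n w).zip (laundryList n w') →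
      (y, y') ∈ (laundryList n w).zip (laundryList n w') → entry w x y = entry w' x' y') :
    ∃ f, IsRelabelling w w' f := by
  obtain ⟨hl, hz⟩ := zip_blocks (bandIdx w) (bandIdx w') (evens n) (odds n)
    (by simpa only [laundryList_eq] using hleft)
  rw [← laundryList_eq, ← laundryList_eq] at hz
  rw [hz] at hentry
  have hcirc : ∀ e ∈ evens n, ((Sum.inl e : Cyc), (Sum.inl e : Cyc)) ∈
      (laundryList n w).zip (laundryList n w') := fun e he => by
    rw [hz, List.mem_append, List.mem_flatMap]
    exact .inl ⟨e, he, by simp⟩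
  have hband : ∀ e ∈ evens n, ∀ k l, (k, l) ∈ (bandIdx w e).zip (bandIdx w' e) →
      ((Sum.inr k : Cyc), (Sum.inr l : Cyc)) ∈ (laundryList n w).zip (laundryList n w') :=
    fun e he k l h => by
      rw [hz, List.mem_append, List.mem_flatMap]
      exact .inl ⟨e, he, List.mem_cons_of_mem _ (List.mem_map.mpr ⟨_, h, rfl⟩)⟩
  rw [hz] at hcirc hband
  have hex : ∀ k, k < w.length → ∃ l, ∃ e ∈ evens n,
      (k, l) ∈ (bandIdx w e).zip (bandIdx w' e) := by
    intro k hk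
    have hmem := (mem_laundryList hw).mpr (.inr ⟨k, hk, rfl⟩)
    simp only [laundryList_eq, List.mem_append, List.mem_flatMap, List.mem_cons, List.mem_map,
      reduceCtorEq, false_or, Sum.inr.injEq, exists_eq_right, and_false, exists_false,
      or_false] at hmem
    obtain ⟨e, he, hke⟩ := hmem
    obtain ⟨p, hp, rfl⟩ := List.getElem_of_mem hke
    have hp' : p < (bandIdx w' e).length := hl e he ▸ hp
    refine ⟨(bandIdx w' e)[p], e, he, ?_⟩
    rw [← List.getElem_zip (h := by simp [hp, hp'])]
    exact List.getElem_mem _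
  choose! f g hg hf using hex
  have hidx : ∀ k < w.length, (k < w.length ∧ (colOf w k = g k - 1 ∨ colOf w k = g k)) ∧
      (f k < w.length ∧ (colOf w' (f k) = g k - 1 ∨ colOf w' (f k) = g k)) := fun k hk => by
    have := List.of_mem_zip (hf k hk)
    rw [mem_bandIdx, mem_bandIdx, hlen] at this
    exact this
  have hsign : ∀ k < w.length, signOf w' (f k) = signOf w k := fun k hk => by
    have hb := hband _ (hg k hk) _ _ (hf k hk)
    simpa [entry] using (hentry _ _ _ _ hb hb).symm
  have hcol : ∀ k < w.length, colOf w' (f k) = colOf w k := fun k hk => by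
    have := hentry _ _ _ _ (hband _ (hg k hk) _ _ (hf k hk)) (hcirc _ (hg k hk))
    have hge := mem_evens.mp (hg k hk)
    have := hidx k hk
    simp only [entry] at *
    grind
  refine ⟨f, hlen, fun k hk => (hidx k hk).2.1, fun k hk => Prod.ext (hcol k hk) (hsign k hk), ?_⟩
  intro k l hkl hll h₁ h₂
  have hkw := hkl.trans hll
  by_cases hc : colOf w k = colOf w l
  · have hgk := mem_evens.mp (hg k hkw)
    have hgl := mem_evens.mp (hg l hll)
    have hik := hidx k hkw
    have hil := hidx l hll
    have hgg : g k = g l := by omega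
    exact lt_of_mem_zip (pairwise_bandIdx _ _) (pairwise_bandIdx _ _) (hf k hkw)
      (hgg ▸ hf l hll) hkl
  · have he := hentry _ _ _ _ (hband _ (hg k hkw) _ _ (hf k hkw)) (hband _ (hg l hll) _ _ (hf l hll))
    have hne : f k ≠ f l := fun e => hc (by rw [← hcol k hkw, ← hcol l hll, e])
    simp only [entry, hcol k hkw, hcol l hll, hne, hkl.ne, if_false, hkl, hkl.not_gt, and_true,
      and_false, or_false] at he
    grind

/-- **Theorem 1.** The linking matrices of two braid words agree
(after the identification `Fin (n + m) ≃ Fin (n' + m')` induced by the equality of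
sizes) if and only if the words have the same number of strands and are B0-equivalent;
i.e. `w ↦ M(w)` is a bijection from braid diagrams onto linking matrices. -/
theorem linkMat_eq_iff_b0Equiv (n m n' m' : ℕ) (w w' : List Letter)
    (hw : IsBraidWord n w) (hw' : IsBraidWord n' w')
    (hm : w.length = m) (hm' : w'.length = m') :
    (∃ h : n + m = n' + m',
        Matrix.reindex (finCongr h) (finCongr h) (linkMat n m w) = linkMat n' m' w') ↔
      n = n' ∧ B0Equiv w w' := by
  subst hm hm'
  constructor
  · rintro ⟨h, hM⟩
    have hL := length_laundryList hw
    have hL' := length_laundryList hw'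
    have hent : ∀ p q (hp : p < (laundryList n w).length) (hq : q < (laundryList n w).length)
        (hp' : p < (laundryList n' w').length) (hq' : q < (laundryList n' w').length),
        entry w (laundryList n w)[p] (laundryList n w)[q] =
          entry w' (laundryList n' w')[p] (laundryList n' w')[q] := by
      intro p q hp hq hp' hq'
      have := congrFun (congrFun hM ⟨p, by omega⟩) ⟨q, by omega⟩
      simpa [linkMat, hp, hq, hp', hq'] using this
    have hleft : (laundryList n w).map Sum.isLeft = (laundryList n' w').map Sum.isLeft := by
      refine List.ext_getElem (by simp only [List.length_map]; omega) fun p hp hp' => ?_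
      rw [List.length_map] at hp hp'
      rw [List.getElem_map, List.getElem_map, Bool.eq_iff_iff,
        isLeft_iff_entry_self_eq_zero hw (List.getElem_mem _),
        isLeft_iff_entry_self_eq_zero hw' (List.getElem_mem _), hent p p hp hp hp' hp']
    have hn : n = n' := by
      rw [← countP_isLeft_laundryList hw, ← countP_isLeft_laundryList hw']
      have := congrArg (List.countP id) hleft
      simpa only [List.countP_map, Function.id_comp] using this
    subst hn
    refine ⟨rfl, ?_⟩
    obtain ⟨f, hf⟩ := exists_isRelabelling_of_entry_eq hw (by omega) hleft (by
      intro x x' y y' hx hy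
      obtain ⟨p, hp, e⟩ := List.getElem_of_mem hx
      obtain ⟨q, hq, e'⟩ := List.getElem_of_mem hy
      simp only [List.getElem_zip, Prod.mk.injEq] at e e'
      rw [← e.1, ← e.2, ← e'.1, ← e'.2]
      exact hent p q _ _ _ _)
    exact hf.b0Equiv
  · rintro ⟨rfl, h⟩
    obtain ⟨-, hlen, hM⟩ := h.length_eq_and_linkMat_eq hw
    refine ⟨by rw [hlen], ?_⟩
    rw [hM]
    ext p q
    rfl
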